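/- Let A and B be n×n complex positive definite matrices that commute (AB = BA), set C = A^{-1}(A#B), and let D be the (real) Fréchet derivative of the geometric mean map G(A,B) = A#B at (A,B). Then C is Hermitian positive definite, and for all Hermitian matrices X, Y: ‖D(X,Y)‖ ≤ (1/(2·λ_min(C)))·(1 + ‖C‖²)·max(‖X‖, ‖Y‖), where λ_min(C) is the smallest eigenvalue of C. -/

import Mathlib

open Matrix MeasureTheory Real
open scoped Matrix.Norms.L2Operator ComplexOrder

-- the positive semidefinite square root of a positive semidefinite matrix, as in the older Mathlib
noncomputable def Matrix.PosSemidef.sqrt {n 𝕜 : Type*} [Fintype n] [RCLike 𝕜] [DecidableEq n]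
    {A : Matrix n n 𝕜} (hA : A.PosSemidef) : Matrix n n 𝕜 :=
  hA.1.eigenvectorUnitary.1 * diagonal ((↑) ∘ Real.sqrt ∘ hA.1.eigenvalues) *
    (star hA.1.eigenvectorUnitary : Matrix n n 𝕜)

-- `psqrt M` is the unique positive semidefinite square root of a positive semidefinite matrix
open Classical in
noncomputable def psqrt {n : ℕ} (M : Matrix (Fin n) (Fin n) ℂ) : Matrix (Fin n) (Fin n) ℂ :=
  if h : M.PosSemidef then h.sqrt else 0

-- the geometric mean  A#B = A^{1/2} (A^{-1/2} B A^{-1/2})^{1/2} A^{1/2}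
noncomputable def gm {n : ℕ} (A B : Matrix (Fin n) (Fin n) ℂ) : Matrix (Fin n) (Fin n) ℂ :=
  psqrt A * psqrt ((psqrt A)⁻¹ * B * (psqrt A)⁻¹) * psqrt A

-- entrywise complex conjugate
def mconj {n : ℕ} (M : Matrix (Fin n) (Fin n) ℂ) : Matrix (Fin n) (Fin n) ℂ := Mᴴᵀ

-- smallest eigenvalue of a Hermitian matrix
noncomputable def lmin {n : ℕ} {C : Matrix (Fin n) (Fin n) ℂ} (hC : C.IsHermitian) : ℝ :=
  ⨅ i, hC.eigenvalues i

open scoped MatrixOrder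

lemma psd_sqrt_spec {n : ℕ} {M : Matrix (Fin n) (Fin n) ℂ} (h : M.PosSemidef) :
    h.sqrt.PosSemidef ∧ h.sqrt * h.sqrt = M := by
  have hU : (star h.1.eigenvectorUnitary : Matrix (Fin n) (Fin n) ℂ) *
      (h.1.eigenvectorUnitary : Matrix (Fin n) (Fin n) ℂ) = 1 := by simp
  constructor
  · unfold Matrix.PosSemidef.sqrt
    apply Matrix.PosSemidef.mul_mul_conjTranspose_same
    apply Matrix.PosSemidef.diagonal
    intro i
    simp [Real.sqrt_nonneg]
  · have hs := h.1.spectral_theorem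
    rw [Unitary.conjStarAlgAut_apply] at hs
    conv_rhs => rw [hs]
    unfold Matrix.PosSemidef.sqrt
    calc _ = (h.1.eigenvectorUnitary : Matrix (Fin n) (Fin n) ℂ) *
          diagonal (RCLike.ofReal ∘ Real.sqrt ∘ h.1.eigenvalues) *
          ((star h.1.eigenvectorUnitary : Matrix (Fin n) (Fin n) ℂ) *
            (h.1.eigenvectorUnitary : Matrix (Fin n) (Fin n) ℂ)) *
          diagonal (RCLike.ofReal ∘ Real.sqrt ∘ h.1.eigenvalues) *
          (star h.1.eigenvectorUnitary : Matrix (Fin n) (Fin n) ℂ) := by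
            simp only [Matrix.mul_assoc]
      _ = _ := by
        rw [hU, Matrix.mul_one, Matrix.mul_assoc _ (diagonal _) (diagonal _),
          Matrix.diagonal_mul_diagonal]
        congr 3
        ext i
        have := Real.mul_self_sqrt (h.eigenvalues_nonneg i)
        simp only [Function.comp]
        rw [← RCLike.ofReal_mul, this]

lemma psqrt_psd {n : ℕ} {M : Matrix (Fin n) (Fin n) ℂ} (h : M.PosSemidef) :
    (psqrt M).PosSemidef := by
  rw [psqrt, dif_pos h]; exact (psd_sqrt_spec h).1

lemma psqrt_mul {n : ℕ} {M : Matrix (Fin n) (Fin n) ℂ} (h : M.PosSemidef) :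
    psqrt M * psqrt M = M := by
  rw [psqrt, dif_pos h]; exact (psd_sqrt_spec h).2

lemma psqrt_pd {n : ℕ} {M : Matrix (Fin n) (Fin n) ℂ} (h : M.PosDef) :
    (psqrt M).PosDef := by
  rw [(psqrt_psd h.posSemidef).posDef_iff_isUnit]
  have h1 := h.isUnit
  rw [← psqrt_mul h.posSemidef] at h1
  exact isUnit_of_mul_isUnit_left h1

lemma psqrt_comm {n : ℕ} {M N : Matrix (Fin n) (Fin n) ℂ} (h : M.PosSemidef)
    (hc : Commute M N) : Commute (psqrt M) N := by
  have : CFC.sqrt M = psqrt M :=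
    CFC.sqrt_unique (psqrt_mul h) (Matrix.nonneg_iff_posSemidef.2 (psqrt_psd h))
  rw [← this]
  exact hc.cfcₙ_nnreal _

/-- the inner factor of the geometric mean -/
lemma inner_pd {n : ℕ} {A B : Matrix (Fin n) (Fin n) ℂ} (hA : A.PosDef) (hB : B.PosDef) :
    ((psqrt A)⁻¹ * B * (psqrt A)⁻¹).PosDef := by
  have hS := (psqrt_pd hA).inv
  have := (Matrix.IsUnit.posDef_star_right_conjugate_iff hS.isUnit).2 hB
  rwa [show star (psqrt A)⁻¹ = (psqrt A)⁻¹ from hS.1] at this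

lemma gm_herm {n : ℕ} {A B : Matrix (Fin n) (Fin n) ℂ} (hA : A.PosDef) (hB : B.PosDef) :
    (gm A B).IsHermitian := by
  have hS := (psqrt_pd hA)
  have hT := psqrt_pd (inner_pd hA hB)
  have := (Matrix.IsUnit.posDef_star_right_conjugate_iff hS.isUnit).2 hT
  rw [show star (psqrt A) = (psqrt A) from hS.1] at this
  exact this.1

lemma gm_eq {n : ℕ} {A B : Matrix (Fin n) (Fin n) ℂ} (hA : A.PosDef) (hB : B.PosDef) :
    gm A B * A⁻¹ * gm A B = B := by
  have hS := (psqrt_pd hA)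
  have hd := (Matrix.isUnit_iff_isUnit_det _).1 hS.isUnit
  have hT := psqrt_mul (inner_pd hA hB).posSemidef
  have hAi : A⁻¹ = (psqrt A)⁻¹ * (psqrt A)⁻¹ := by
    rw [← Matrix.mul_inv_rev, psqrt_mul hA.posSemidef]
  unfold gm
  rw [hAi]
  generalize psqrt ((psqrt A)⁻¹ * B * (psqrt A)⁻¹) = T at *
  generalize psqrt A = S at *
  calc _ = S * T * (S * S⁻¹) * (S⁻¹ * S) * T * S := by simp only [Matrix.mul_assoc]
    _ = S * (T * T) * S := by
      rw [Matrix.mul_nonsing_inv _ hd, Matrix.nonsing_inv_mul _ hd]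
      simp only [Matrix.mul_assoc, Matrix.one_mul]
    _ = (S * S⁻¹) * B * (S⁻¹ * S) := by rw [hT]; simp only [Matrix.mul_assoc]
    _ = B := by
      rw [Matrix.mul_nonsing_inv _ hd, Matrix.nonsing_inv_mul _ hd]; simp

lemma gm_comm {n : ℕ} {A B : Matrix (Fin n) (Fin n) ℂ} (hA : A.PosDef) (hB : B.PosDef)
    (hAB : A * B = B * A) :
    (A⁻¹ * gm A B).PosDef ∧ gm A B * A⁻¹ = A⁻¹ * gm A B := by
  have hS := (psqrt_pd hA)
  have hd := (Matrix.isUnit_iff_isUnit_det _).1 hS.isUnit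
  have hTp := psqrt_pd (inner_pd hA hB)
  have hAi : A⁻¹ = (psqrt A)⁻¹ * (psqrt A)⁻¹ := by
    rw [← Matrix.mul_inv_rev, psqrt_mul hA.posSemidef]
  have hSB : Commute (psqrt A) B := psqrt_comm hA.posSemidef hAB
  have h1 : Commute (psqrt A) (psqrt A)⁻¹ := by
    rw [commute_iff_eq, Matrix.mul_nonsing_inv _ hd, Matrix.nonsing_inv_mul _ hd]
  have hTS := psqrt_comm (inner_pd hA hB).posSemidef ((h1.mul_right hSB).mul_right h1).symm
  unfold gm
  rw [hAi]
  generalize psqrt ((psqrt A)⁻¹ * B * (psqrt A)⁻¹) = T at *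
  generalize psqrt A = S at *
  have e1 : S⁻¹ * S⁻¹ * (S * T * S) = T := by
    rw [show S * T * S = S * (S * T) by rw [Matrix.mul_assoc, hTS.eq]]
    calc _ = S⁻¹ * (S⁻¹ * S) * S * T := by simp only [Matrix.mul_assoc]
      _ = T := by rw [Matrix.nonsing_inv_mul _ hd, Matrix.mul_one, Matrix.nonsing_inv_mul _ hd,
                    Matrix.one_mul]
  have e2 : (S * T * S) * (S⁻¹ * S⁻¹) = T := by
    rw [← hTS.eq]
    calc _ = T * (S * (S * S⁻¹) * S⁻¹) := by simp only [Matrix.mul_assoc]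
      _ = T := by rw [Matrix.mul_nonsing_inv _ hd, Matrix.mul_one, Matrix.mul_nonsing_inv _ hd,
                    Matrix.mul_one]
  rw [e1, e2]
  exact ⟨hTp, rfl⟩

lemma lmin_pos {n : ℕ} (hn : 0 < n) {C : Matrix (Fin n) (Fin n) ℂ} (hC : C.PosDef) :
    0 < lmin hC.1 := by
  have : Nonempty (Fin n) := ⟨⟨0, hn⟩⟩
  obtain ⟨i, hi⟩ := exists_eq_ciInf_of_finite (f := hC.1.eigenvalues)
  rw [lmin, ← hi]
  exact hC.eigenvalues_pos i

lemma lmin_le {n : ℕ} {C : Matrix (Fin n) (Fin n) ℂ} (hC : C.IsHermitian) :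
    algebraMap ℝ (Matrix (Fin n) (Fin n) ℂ) (lmin hC) ≤ C := by
  have hsa : IsSelfAdjoint C := hC
  rw [algebraMap_le_iff_le_spectrum hsa]
  intro x hx
  rw [hC.spectrum_real_eq_range_eigenvalues] at hx
  obtain ⟨i, rfl⟩ := hx
  exact ciInf_le (Set.finite_range _).bddBelow i

lemma pd_perturb {n : ℕ} (hn : 0 < n) {A X : Matrix (Fin n) (Fin n) ℂ} (hA : A.PosDef)
    (hX : X.IsHermitian) : ∀ᶠ t : ℝ in nhds 0, (A + t • X).PosDef := by
  have hc := lmin_pos hn hA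
  have hcont : Filter.Tendsto (fun t : ℝ => ‖t • X‖) (nhds 0) (nhds 0) := by
    have : Continuous (fun t : ℝ => ‖t • X‖) := by fun_prop
    simpa using this.tendsto 0
  filter_upwards [hcont.eventually_lt_const hc] with t ht
  have hsa : IsSelfAdjoint (t • X) := IsSelfAdjoint.smul (by simp [IsSelfAdjoint]) hX
  have h1 := add_le_add (lmin_le hA.1) hsa.neg_algebraMap_norm_le_self
  rw [← sub_eq_add_neg, ← map_sub] at h1
  have h2 : IsStrictlyPositive (algebraMap ℝ (Matrix (Fin n) (Fin n) ℂ) (lmin hA.1 - ‖t • X‖)) := by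
    apply Matrix.PosDef.isStrictlyPositive
    rw [Algebra.algebraMap_eq_smul_one]
    exact Matrix.PosDef.one.smul (sub_pos.2 ht)
  exact (h2.of_le h1).posDef

lemma sylvester_bound {n : ℕ} (hn : 0 < n) {C Z : Matrix (Fin n) (Fin n) ℂ} (hC : C.PosDef)
    (hZ : Z.IsHermitian) : 2 * lmin hC.1 * ‖Z‖ ≤ ‖Z * C + C * Z‖ := by
  have : Nonempty (Fin n) := ⟨⟨0, hn⟩⟩
  have hsa : IsSelfAdjoint Z := hZ
  obtain ⟨i, hi⟩ : ∃ i, |hZ.eigenvalues i| = ‖Z‖ := by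
    have := CStarAlgebra.norm_or_neg_norm_mem_spectrum hsa
    rw [hZ.spectrum_real_eq_range_eigenvalues] at this
    rcases this with ⟨i, hi⟩ | ⟨i, hi⟩
    · exact ⟨i, by rw [hi, abs_norm]⟩
    · exact ⟨i, by rw [hi, abs_neg, abs_norm]⟩
  set μ := hZ.eigenvalues i
  set e := hZ.eigenvectorBasis i
  have he : ‖e‖ = 1 := hZ.eigenvectorBasis.orthonormal.1 i
  set v : Fin n → ℂ := e.ofLp
  have hv : Z *ᵥ v = μ • v := hZ.mulVec_eigenvectorBasis i
  have hv' : star v ᵥ* Z = μ • star v := by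
    have := congrArg star hv
    rw [Matrix.star_mulVec, hZ.eq] at this
    simpa using this
  have hvv : star v ⬝ᵥ v = 1 := by
    have := EuclideanSpace.inner_eq_star_dotProduct e e
    rw [inner_self_eq_norm_sq_to_K, he] at this
    rw [dotProduct_comm, ← this]; simp
  have hq : star v ⬝ᵥ ((Z * C + C * Z) *ᵥ v) = ((2 * μ : ℝ) : ℂ) * (star v ⬝ᵥ (C *ᵥ v)) := by
    rw [Matrix.add_mulVec, dotProduct_add, ← Matrix.mulVec_mulVec, ← Matrix.mulVec_mulVec, hv,
      Matrix.dotProduct_mulVec (star v) Z, hv', Matrix.mulVec_smul, dotProduct_smul,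
      smul_dotProduct]
    simp only [Complex.real_smul]
    push_cast
    ring
  have hlow : lmin hC.1 ≤ ‖star v ⬝ᵥ (C *ᵥ v)‖ := by
    have h := (Matrix.le_iff.1 (lmin_le hC.1)).re_dotProduct_nonneg v
    rw [Algebra.algebraMap_eq_smul_one, Matrix.sub_mulVec, dotProduct_sub, Matrix.smul_mulVec,
      Matrix.one_mulVec, dotProduct_smul, hvv] at h
    simp at h
    exact h.trans (Complex.re_le_norm _)
  have hup : ‖star v ⬝ᵥ ((Z * C + C * Z) *ᵥ v)‖ ≤ ‖Z * C + C * Z‖ := by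
    have h1 := Matrix.l2_opNorm_mulVec (Z * C + C * Z) e
    have h2 := norm_inner_le_norm (𝕜 := ℂ) e (WithLp.toLp 2 ((Z * C + C * Z) *ᵥ v))
    rw [EuclideanSpace.inner_eq_star_dotProduct, he, one_mul, dotProduct_comm] at h2
    rw [he, mul_one] at h1
    exact h2.trans h1
  rw [hq, norm_mul, Complex.norm_real, Real.norm_eq_abs, abs_mul, hi, abs_two] at hup
  nlinarith [norm_nonneg Z, mul_le_mul_of_nonneg_left hlow (norm_nonneg Z)]

lemma curve_deriv {E F : Type*} [NormedAddCommGroup E] [NormedSpace ℝ E]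
    [NormedAddCommGroup F] [NormedSpace ℝ F] (f : E × E → F) (D : E × E →L[ℝ] F) (s : Set (E × E))
    (A B X Y : E) (hD : HasFDerivWithinAt f D s (A, B))
    (hs : ∀ t : ℝ, (A + t • X, B + t • Y) ∈ s) :
    HasDerivAt (fun t : ℝ => f (A + t • X, B + t • Y)) (D (X, Y)) 0 := by
  have hlinX : HasDerivAt (fun t : ℝ => A + t • X) X 0 := by
    simpa using ((hasDerivAt_id (0 : ℝ)).smul_const X).const_add A
  have hlinY : HasDerivAt (fun t : ℝ => B + t • Y) Y 0 := by
    simpa using ((hasDerivAt_id (0 : ℝ)).smul_const Y).const_add B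
  exact HasFDerivWithinAt.comp_hasDerivAt_of_eq (0 : ℝ) hD (hlinX.prodMk hlinY)
    (Filter.Eventually.of_forall hs) (by simp)

theorem stmt5 {n : ℕ} (hn : 0 < n) (A B : Matrix (Fin n) (Fin n) ℂ)
    (hA : A.PosDef) (hB : B.PosDef) (hAB : A * B = B * A)
    (C : Matrix (Fin n) (Fin n) ℂ) (hC : C = A⁻¹ * gm A B)
    (D : Matrix (Fin n) (Fin n) ℂ × Matrix (Fin n) (Fin n) ℂ →L[ℝ] Matrix (Fin n) (Fin n) ℂ)
    (hD : HasFDerivWithinAt (fun p : Matrix (Fin n) (Fin n) ℂ × Matrix (Fin n) (Fin n) ℂ =>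
        gm p.1 p.2) D
      {p : Matrix (Fin n) (Fin n) ℂ × Matrix (Fin n) (Fin n) ℂ |
        p.1.IsHermitian ∧ p.2.IsHermitian} (A, B)) :
    ∃ hCpd : C.PosDef,
      ∀ X Y : Matrix (Fin n) (Fin n) ℂ, X.IsHermitian → Y.IsHermitian →
        ‖D (X, Y)‖ ≤ 1 / (2 * lmin hCpd.1) * (1 + ‖C‖ ^ 2) * max ‖X‖ ‖Y‖ := by
  obtain ⟨hCpd, hcm⟩ := gm_comm hA hB hAB
  rw [← hC] at hCpd hcm
  refine ⟨hCpd, fun X Y hX hY => ?_⟩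
  have hl := lmin_pos hn hCpd
  have hlinX : HasDerivAt (fun t : ℝ => A + t • X) X 0 := by
    simpa using ((hasDerivAt_id (0 : ℝ)).smul_const X).const_add A
  have hlinY : HasDerivAt (fun t : ℝ => B + t • Y) Y 0 := by
    simpa using ((hasDerivAt_id (0 : ℝ)).smul_const Y).const_add B
  have hM : HasDerivAt (fun t : ℝ => gm (A + t • X) (B + t • Y)) (D (X, Y)) 0 := by
    refine curve_deriv _ D _ A B X Y hD fun t => ⟨?_, ?_⟩
    · exact IsSelfAdjoint.add hA.1 (IsSelfAdjoint.smul (by simp [IsSelfAdjoint]) hX)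
    · exact IsSelfAdjoint.add hB.1 (IsSelfAdjoint.smul (by simp [IsSelfAdjoint]) hY)
  have hev : ∀ᶠ t : ℝ in nhds 0, (A + t • X).PosDef ∧ (B + t • Y).PosDef :=
    (pd_perturb hn hA hX).and (pd_perturb hn hB hY)
  have hZ : (D (X, Y)).IsHermitian := by
    have h1 : HasDerivAt (fun t : ℝ => gm (A + t • X) (B + t • Y)) (star (D (X, Y))) 0 := by
      refine hM.star.congr_of_eventuallyEq ?_
      filter_upwards [hev] with t ht
      exact (gm_herm ht.1 ht.2).symm
    exact h1.unique hM
  have hinv : HasDerivAt (fun t : ℝ => (A + t • X)⁻¹) (-(A⁻¹ * X * A⁻¹)) 0 := by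
    obtain ⟨u, hu⟩ := hA.isUnit
    have h1 := hasFDerivAt_ringInverse (𝕜 := ℝ) u
    have h2 := h1.comp_hasDerivAt_of_eq (0 : ℝ) hlinX (by simp [hu])
    have hui : (↑u⁻¹ : Matrix (Fin n) (Fin n) ℂ) = A⁻¹ := by
      rw [← hu, Matrix.coe_units_inv]
    simp only [Matrix.nonsing_inv_eq_ringInverse]
    rw [← Matrix.nonsing_inv_eq_ringInverse, ← hui]
    exact h2.congr_deriv (by simp)
  have hprod := (hM.mul hinv).mul hM
  have hB' := hlinY.congr_of_eventuallyEq (f₁ := fun t : ℝ => gm (A + t • X) (B + t • Y) *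
    (A + t • X)⁻¹ * gm (A + t • X) (B + t • Y)) (by
      filter_upwards [hev] with t ht
      exact gm_eq ht.1 ht.2)
  have heq := hprod.unique hB'
  simp only [Pi.mul_apply, zero_smul, add_zero] at heq
  have hsyl : D (X, Y) * C + C * D (X, Y) = Y + C * X * C := by
    have e1 : D (X, Y) * C = D (X, Y) * A⁻¹ * gm A B := by rw [hC, Matrix.mul_assoc]
    have e2 : C * D (X, Y) = gm A B * A⁻¹ * D (X, Y) := by rw [hcm]
    have e3 : C * X * C = gm A B * (A⁻¹ * X * A⁻¹) * gm A B := by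
      rw [← hcm, Matrix.mul_assoc _ X, hcm, hC]
      rw [show A⁻¹ * gm A B * (X * (A⁻¹ * gm A B)) = C * (X * (A⁻¹ * gm A B)) by rw [hC],
        ← hcm]
      simp only [Matrix.mul_assoc]
    rw [e1, e2, e3]
    generalize D (X, Y) = Z at heq ⊢
    rw [← heq]
    noncomm_ring
  have hb := sylvester_bound hn hCpd hZ
  rw [hsyl] at hb
  have hup : ‖Y + C * X * C‖ ≤ (1 + ‖C‖ ^ 2) * max ‖X‖ ‖Y‖ := by
    calc _ ≤ ‖Y‖ + ‖C‖ * ‖X‖ * ‖C‖ := (norm_add_le _ _).trans (by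
            gcongr
            exact (norm_mul_le _ _).trans (by gcongr; exact norm_mul_le _ _))
      _ = ‖Y‖ + ‖C‖ ^ 2 * ‖X‖ := by ring
      _ ≤ max ‖X‖ ‖Y‖ + ‖C‖ ^ 2 * max ‖X‖ ‖Y‖ := by
            gcongr
            · exact le_max_right _ _
            · exact le_max_left _ _
      _ = _ := by ring
  rw [mul_assoc, one_div, inv_mul_eq_div, le_div_iff₀ (by positivity)]
  linarith
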